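/- For every real number x, the function z ↦ (4·arcsin(z/2)² − z²) / ((1 − 4x²·arcsin(z/2)²)·(1 − x²z²)) is real-analytic at z = 0, its Taylor coefficients at z = 0 of odd order vanish, and for every even integer n ≥ 4 its Taylor coefficient of order n equals B_n(x) = Σ x^{2k−2} · Π_{j=1}^{k} C_{2 i_j}, where the sum is over all integers k ≥ 1 and all compositions (i_1,…,i_k) of n/2 into positive parts other than the all-ones composition (1,1,…,1), and its Taylor coefficients of orders 0 and 2 vanish. -/

import Mathlib

/-- `C_{2r} = 2·((r−1)!)²/(2r)!` for `r ≥ 1`, the Taylor coefficients of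
`4·arcsin(z/2)² = Σ_{r≥1} C_{2r} z^{2r}`. -/
noncomputable def Ccoef (m : ℕ) : ℝ :=
  2 * ((m / 2 - 1).factorial : ℝ) ^ 2 / (m.factorial : ℝ)

/-- `B_n(x) = Σ x^{2k−2}·Π_{j=1}^k C_{2 i_j}`, the sum over all `k ≥ 1` and all
compositions `(i_1,…,i_k)` of `n/2` into positive parts other than the all-ones
composition (so `B_0 = B_2 = 0`). -/
noncomputable def Bfun (n : ℕ) (x : ℝ) : ℝ :=
  ∑ᶠ p ∈ {p : Σ k : ℕ, Fin k → ℕ |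
      1 ≤ p.1 ∧ (∀ j, 0 < p.2 j) ∧ (∑ j, p.2 j) = n / 2 ∧ p.2 ≠ fun _ => 1},
    x ^ (2 * p.1 - 2) * ∏ j, Ccoef (2 * p.2 j)

open PowerSeries Filter Topology in
/-- Taylor series at zero. -/
noncomputable def TT (f : ℝ → ℝ) : PowerSeries ℝ :=
  PowerSeries.mk fun n => iteratedDeriv n f 0 / (n.factorial : ℝ)

namespace BT
open PowerSeries Filter Topology

lemma TT_congr {f g : ℝ → ℝ} (h : f =ᶠ[𝓝 0] g) : TT f = TT g := by
  ext n
  simp only [TT, coeff_mk, h.iteratedDeriv_eq]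

lemma TT_add {f g : ℝ → ℝ} (hf : AnalyticAt ℝ f 0) (hg : AnalyticAt ℝ g 0) :
    TT (fun z => f z + g z) = TT f + TT g := by
  ext n
  simp only [TT, coeff_mk, map_add]
  rw [iteratedDeriv_fun_add hf.contDiffAt hg.contDiffAt, add_div]

lemma TT_sub {f g : ℝ → ℝ} (hf : AnalyticAt ℝ f 0) (hg : AnalyticAt ℝ g 0) :
    TT (fun z => f z - g z) = TT f - TT g := by
  ext n
  simp only [TT, coeff_mk, map_sub]
  rw [iteratedDeriv_fun_sub hf.contDiffAt hg.contDiffAt, sub_div]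

lemma TT_mul {f g : ℝ → ℝ} (hf : AnalyticAt ℝ f 0) (hg : AnalyticAt ℝ g 0) :
    TT (fun z => f z * g z) = TT f * TT g := by
  ext n
  rw [coeff_mul, Finset.Nat.sum_antidiagonal_eq_sum_range_succ_mk]
  simp only [TT, coeff_mk]
  rw [iteratedDeriv_fun_mul hf.contDiffAt hg.contDiffAt, Finset.sum_div]
  refine Finset.sum_congr rfl fun i hi => ?_
  have hi' : i ≤ n := Nat.lt_succ_iff.mp (Finset.mem_range.mp hi)
  rw [Nat.cast_choose ℝ hi']
  have h1 : (n.factorial : ℝ) ≠ 0 := by positivity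
  have h2 : (i.factorial : ℝ) ≠ 0 := by positivity
  have h3 : ((n-i).factorial : ℝ) ≠ 0 := by positivity
  field_simp

lemma TT_const (c : ℝ) : TT (fun _ => c) = C c := by
  ext n
  simp only [TT, coeff_mk, iteratedDeriv_const, coeff_C]
  split_ifs with h <;> simp [h]

lemma TT_deriv (f : ℝ → ℝ) : TT (deriv f) = derivative ℝ (TT f) := by
  ext n
  simp only [TT, coeff_mk, coeff_derivative]
  rw [← iteratedDeriv_succ', Nat.factorial_succ]
  have h1 : (n.factorial : ℝ) ≠ 0 := by positivity
  have h2 : (n + 1 : ℝ) ≠ 0 := by positivity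
  push_cast
  field_simp

lemma TT_id : TT (fun z => z) = X := by
  ext n
  rcases n with _ | n
  · simp [TT]
  · have h : deriv (fun z : ℝ => z) = fun _ => 1 := by ext; simp
    simp only [TT, coeff_mk, coeff_X]
    rw [iteratedDeriv_succ', h, iteratedDeriv_const]
    rcases n with _ | n <;> simp

/-- four arcsin squared -/
noncomputable def AA (z : ℝ) : ℝ := 4 * Real.arcsin (z / 2) ^ 2

lemma AA_an : AnalyticAt ℝ AA 0 := by
  have h : AnalyticAt ℝ Real.arcsin ((fun z : ℝ => z / 2) 0) := by
    have := Real.contDiffAt_arcsin (x := (0:ℝ)/2) (by norm_num) (by norm_num) (n := ⊤)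
    exact this.analyticAt
  have h2 : AnalyticAt ℝ (fun z : ℝ => z / 2) 0 := by fun_prop
  have h3 : AnalyticAt ℝ (fun z : ℝ => Real.arcsin (z / 2)) 0 :=
    AnalyticAt.comp (g := Real.arcsin) h h2
  unfold AA
  fun_prop

lemma hasDeriv_u {z : ℝ} (hz : |z| < 1) :
    HasDerivAt (fun z : ℝ => Real.arcsin (z / 2)) (1 / √(4 - z ^ 2)) z := by
  have hz' := abs_lt.mp hz
  have h := (Real.hasDerivAt_arcsin (x := z / 2) (by linarith) (by linarith)).comp z
    ((hasDerivAt_id z).div_const 2)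
  refine HasDerivAt.congr_deriv (f := fun z : ℝ => Real.arcsin (z / 2)) h ?_
  have : (4 - z ^ 2) = 2 ^ 2 * (1 - (z / 2) ^ 2) := by ring
  rw [this, Real.sqrt_mul (by norm_num), Real.sqrt_sq (by norm_num)]
  ring

lemma hasDeriv_w {z : ℝ} (hz : |z| < 1) :
    HasDerivAt (fun z : ℝ => 1 / √(4 - z ^ 2)) (z * (1 / √(4 - z ^ 2)) ^ 3) z := by
  have hz' := abs_lt.mp hz
  have hp : 0 < 4 - z ^ 2 := by nlinarith
  have h1 : HasDerivAt (fun z : ℝ => 4 - z ^ 2) (-(2 * z)) z := by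
    simpa using ((hasDerivAt_id z).pow 2).const_sub 4
  have h := (h1.sqrt hp.ne').inv (Real.sqrt_pos.mpr hp).ne'
  have hs := (Real.sqrt_pos.mpr hp).ne'
  refine (h.congr_deriv ?_).congr_of_eventuallyEq ?_
  · field_simp
  · exact Eventually.of_forall fun y => by simp

lemma nhd : ∀ᶠ z : ℝ in 𝓝 0, |z| < 1 := by
  filter_upwards [Metric.ball_mem_nhds (0:ℝ) one_pos] with z hz
  simpa using hz

lemma dA {z : ℝ} (hz : |z| < 1) :
    deriv AA z = 8 * (Real.arcsin (z / 2) * (1 / √(4 - z ^ 2))) := by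
  have := (((hasDeriv_u hz).pow 2).const_mul 4).deriv
  unfold AA
  refine Eq.trans this ?_
  simp; ring

lemma ddA {z : ℝ} (hz : |z| < 1) :
    (4 - z * z) * deriv (deriv AA) z = 8 + z * deriv AA z := by
  have hev : deriv AA =ᶠ[𝓝 z] fun z => 8 * (Real.arcsin (z / 2) * (1 / √(4 - z ^ 2))) := by
    have : {y : ℝ | |y| < 1} ∈ 𝓝 z := (isOpen_lt continuous_abs continuous_const).mem_nhds hz
    filter_upwards [this] with y hy using dA hy
  rw [hev.deriv_eq, dA hz]
  have := (((hasDeriv_u hz).mul (hasDeriv_w hz)).const_mul 8).deriv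
  have e : deriv (fun z => 8 * (Real.arcsin (z / 2) * (1 / √(4 - z ^ 2)))) z = _ := this
  rw [e]
  have hz' := abs_lt.mp hz
  have hp : 0 < 4 - z ^ 2 := by nlinarith
  have hs : (1 / √(4 - z ^ 2)) ^ 2 * (4 - z ^ 2) = 1 := by
    rw [div_pow, Real.sq_sqrt hp.le]; field_simp
  generalize 1 / √(4 - z ^ 2) = w at *
  linear_combination (8 + 8 * z * w * Real.arcsin (z / 2)) * hs

lemma ode : (C 4 - X * X) * derivative ℝ (derivative ℝ (TT AA)) =
    C 8 + X * derivative ℝ (TT AA) := by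
  have h1 := AA_an.deriv
  have h2 := h1.deriv
  rw [← TT_deriv, ← TT_deriv, ← TT_id, ← TT_const, ← TT_const,
    ← TT_mul (by fun_prop) (by fun_prop), ← TT_mul (by fun_prop) h1,
    ← TT_add (by fun_prop) (by fun_prop), ← TT_sub (by fun_prop) (by fun_prop),
    ← TT_mul (by fun_prop) (by fun_prop)]
  apply TT_congr
  filter_upwards [nhd] with z hz using ddA hz

/-- coefficient series -/
noncomputable def cc : PowerSeries ℝ := PowerSeries.mk fun r => if r = 0 then 0 else Ccoef (2 * r)

lemma C_two : Ccoef 2 = 1 := by simp [Ccoef]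

lemma C_rec (r : ℕ) : Ccoef (2 * (r + 1 + 1)) * ((2*r+4) * (2*r+3)) = (r+1)^2 * Ccoef (2 * (r+1)) := by
  have e1 : 2 * (r+1+1) / 2 - 1 = r + 1 := by omega
  have e2 : 2 * (r+1) / 2 - 1 = r := by omega
  have e3 : 2 * (r+1+1) = (2 * (r+1)) + 1 + 1 := by ring
  unfold Ccoef
  rw [e1, e2, e3, Nat.factorial_succ (2*(r+1)+1), Nat.factorial_succ (2*(r+1)), Nat.factorial_succ r]
  have h1 : ((2*(r+1)).factorial : ℝ) ≠ 0 := by positivity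
  push_cast
  field_simp
  ring

lemma rec_a (n : ℕ) : 4 * (n+2) * (n+1) * coeff (n+2) (TT AA) =
    n^2 * coeff n (TT AA) + if n = 0 then 8 else 0 := by
  have h := congrArg (coeff n) ode
  rw [sub_mul, mul_assoc] at h
  simp only [map_sub, map_add, coeff_C_mul, coeff_C] at h
  rcases n with _ | _ | n
  · simp [coeff_derivative, coeff_zero_X_mul, -coeff_zero_eq_constantCoeff] at h ⊢
    linarith
  · simp [coeff_derivative, coeff_succ_X_mul, coeff_zero_X_mul, -coeff_zero_eq_constantCoeff] at h ⊢
    norm_num at h ⊢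
    linarith
  · simp [coeff_derivative, coeff_succ_X_mul] at h ⊢
    linarith

lemma TA : TT AA = expand 2 two_ne_zero cc := by
  have key : ∀ r : ℕ, coeff (2 * r) (TT AA) = coeff r cc ∧ coeff (2 * r + 1) (TT AA) = 0 := by
    intro r
    induction r with
    | zero =>
      constructor
      · simp [TT, cc, AA]
      · simp [TT, dA (z := 0)]
    | succ r ih =>
      have h1 := rec_a (2 * r)
      have h2 := rec_a (2 * r + 1)
      rw [ih.1] at h1
      rw [ih.2] at h2
      constructor
      · rw [show 2 * (r + 1) = 2 * r + 2 by ring]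
        rcases r with _ | r
        · simp [cc, C_two] at h1 ⊢
          linarith
        · have h3 := C_rec r
          simp only [cc, coeff_mk] at h1 ⊢
          simp at h1 ⊢
          have : (0:ℝ) < (2*r+4) * (2*r+3) := by positivity
          refine mul_right_cancel₀ this.ne' ?_
          linarith
      · rw [show 2 * (r + 1) + 1 = 2 * r + 1 + 2 by ring]
        simp at h2
        rcases h2 with (h2 | h2) | h2
        · exfalso; have : (0:ℝ) < 2 * r + 1 + 2 := by positivity
          linarith
        · exfalso; have : (0:ℝ) < 2 * r + 1 + 1 := by positivity
          linarith
        · exact h2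
  ext n
  rcases Nat.even_or_odd' n with ⟨r, rfl | rfl⟩
  · rw [coeff_expand_mul, (key r).1]
  · rw [(key r).2, coeff_expand_of_not_dvd]
    omega

/-- the function -/
noncomputable def FF (x z : ℝ) : ℝ :=
  (4 * Real.arcsin (z / 2) ^ 2 - z ^ 2) /
          ((1 - 4 * x ^ 2 * Real.arcsin (z / 2) ^ 2) * (1 - x ^ 2 * z ^ 2))

lemma FF_eq (x : ℝ) : FF x = fun z => (AA z - z * z) / ((1 - x ^ 2 * AA z) * (1 - x ^ 2 * (z * z))) := by
  ext z; unfold FF AA; ring_nf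

lemma AA0 : AA 0 = 0 := by simp [AA]

lemma FF_an (x : ℝ) : AnalyticAt ℝ (FF x) 0 := by
  have := AA_an
  rw [FF_eq]
  exact AnalyticAt.fun_div (by fun_prop) (by fun_prop) (by simp [AA0])

lemma FF_mul (x : ℝ) : TT (FF x) * ((1 - C (x^2) * TT AA) * (1 - C (x^2) * (X * X))) =
    TT AA - X * X := by
  have hA := AA_an
  have hF := FF_an x
  rw [← TT_id, ← TT_const, ← map_one C, ← TT_const,
    ← TT_mul (by fun_prop) (by fun_prop), ← TT_mul (by fun_prop) (by fun_prop),
    ← TT_mul (by fun_prop) (by fun_prop),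
    ← TT_sub (by fun_prop) (by fun_prop), ← TT_sub (by fun_prop) (by fun_prop),
    ← TT_sub (by fun_prop) (by fun_prop),
    ← TT_mul (by fun_prop) (by fun_prop), ← TT_mul (by fun_prop) (by fun_prop)]
  apply TT_congr
  have hc : ContinuousAt (fun z => (1 - x ^ 2 * AA z) * (1 - x ^ 2 * (z * z))) 0 := by
    apply AnalyticAt.continuousAt (𝕜 := ℝ); fun_prop
  filter_upwards [hc.eventually_ne (y := 0) (by simp [AA0])] with z hz
  rw [FF_eq]
  exact div_mul_cancel₀ _ hz

lemma cc0 : constantCoeff cc = 0 := by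
  rw [← coeff_zero_eq_constantCoeff_apply]; simp [cc]

/-- partial sum -/
noncomputable def ss (x : ℝ) (N : ℕ) : PowerSeries ℝ :=
  ∑ k ∈ Finset.range N, C (x^(2*k)) * (cc ^ (k+1) - X ^ (k+1))

lemma ss_mul (x : ℝ) (N : ℕ) : ss x N * ((1 - C (x^2) * cc) * (1 - C (x^2) * X)) =
    cc - X - C (x^(2*N)) * (cc ^ (N+1) * (1 - C (x^2) * X) - X ^ (N+1) * (1 - C (x^2) * cc)) := by
  induction N with
  | zero => simp [ss]; ring
  | succ N ih =>
    rw [ss, Finset.sum_range_succ, add_mul, ← ss, ih]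
    simp only [map_pow]
    ring

lemma X_dvd_cc : (X : PowerSeries ℝ) ∣ cc := by
  rw [X_dvd_iff, cc0]

lemma TF_dvd (x : ℝ) (N : ℕ) : (X : PowerSeries ℝ) ^ (N+1) ∣ TT (FF x) - expand 2 two_ne_zero (ss x N) := by
  have h := FF_mul x
  have h2 := congrArg (expand 2 two_ne_zero) (ss_mul x N)
  rw [TA] at h
  simp only [map_mul, map_sub, map_one, map_pow, expand_X, expand_C] at h h2 
  have hd : (X : PowerSeries ℝ) ∣ expand 2 two_ne_zero cc := by
    rw [X_dvd_iff, constantCoeff_expand, cc0]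
  generalize expand 2 two_ne_zero cc = a at *
  have hu : IsUnit ((1 - C x ^2 * a) * (1 - C x ^2 * (X * X)) : PowerSeries ℝ) := by
    rw [isUnit_iff_constantCoeff]
    rw [X_dvd_iff] at hd
    simp [hd]
  rw [← hu.dvd_mul_right]
  have e : (TT (FF x) - expand 2 two_ne_zero (ss x N)) * ((1 - C x ^2 * a) * (1 - C x ^2 * (X * X)) : PowerSeries ℝ)
     = C x ^(2*N) * (a ^ (N+1) * (1 - C x ^2 * X^2) - (X^2) ^ (N+1) * (1 - C x ^2 * a)) := by
    rw [sub_mul, h]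
    linear_combination -h2
  rw [e]
  apply Dvd.dvd.mul_left
  apply dvd_sub
  · exact Dvd.dvd.mul_right (pow_dvd_pow_of_dvd hd _) _
  · exact Dvd.dvd.mul_right (pow_dvd_pow_of_dvd (dvd_pow_self _ two_ne_zero) _) _

lemma coeff_TF (x : ℝ) {n N : ℕ} (h : n ≤ N) :
    coeff n (TT (FF x)) = coeff n (expand 2 two_ne_zero (ss x N)) := by
  have := X_pow_dvd_iff.mp (TF_dvd x N) n (by omega)
  rw [map_sub] at this
  linarith

lemma coeff_cc_pow (k m : ℕ) : coeff m (cc ^ k) =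
    ∑ f ∈ Finset.piAntidiag (Finset.univ : Finset (Fin k)) m, ∏ j, coeff (f j) cc := by
  have h := coeff_prod (fun _ : Fin k => cc) m Finset.univ
  rw [Finset.prod_const, Finset.card_univ, Fintype.card_fin] at h
  rw [h]
  refine Finset.sum_bij (fun l _ => ⇑l) ?_ ?_ ?_ ?_
  · intro l hl; simpa using hl
  · intro a _ b _ hab; exact DFunLike.coe_injective hab
  · intro f hf
    refine ⟨Finsupp.equivFunOnFinite.symm f, ?_, ?_⟩
    · simpa using hf
    · simp
  · intro l _; rfl

lemma coeff_cc_pow_sub (k m : ℕ) : coeff m (cc ^ k - X ^ k) =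
    ∑ f ∈ (Finset.piAntidiag (Finset.univ : Finset (Fin k)) m).filter
      (fun f => (∀ j, 0 < f j) ∧ f ≠ fun _ => 1), ∏ j, Ccoef (2 * f j) := by
  classical
  rw [map_sub, coeff_cc_pow, coeff_X_pow]
  have h1 : ∑ f ∈ Finset.piAntidiag (Finset.univ : Finset (Fin k)) m, ∏ j, coeff (f j) cc
      = ∑ f ∈ (Finset.piAntidiag (Finset.univ : Finset (Fin k)) m).filter (fun f => ∀ j, 0 < f j),
        ∏ j, Ccoef (2 * f j) := by
    rw [Finset.sum_filter]
    refine Finset.sum_congr rfl fun f _ => ?_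
    split_ifs with h
    · refine Finset.prod_congr rfl fun j _ => ?_
      simp [cc, (h j).ne']
    · push Not at h
      obtain ⟨j, hj⟩ := h
      refine Finset.prod_eq_zero (Finset.mem_univ j) ?_
      simp [cc, Nat.le_zero.mp hj]
  have h2 : (if m = k then (1:ℝ) else 0) =
      ∑ f ∈ ((Finset.piAntidiag (Finset.univ : Finset (Fin k)) m).filter (fun f => ∀ j, 0 < f j)).filter
       (fun f => ¬ f ≠ fun _ => 1), ∏ j, Ccoef (2 * f j) := by
    split_ifs with h
    · subst h
      rw [Finset.sum_eq_single (fun _ => 1)]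
      · simp [C_two]
      · intro b hb hb'
        simp at hb
        exact absurd hb.2 hb'
      · intro hh; simp at hh
    · symm
      apply Finset.sum_eq_zero
      intro f hf
      simp at hf
      exfalso
      obtain ⟨⟨h3, _⟩, rfl⟩ := hf
      simp at h3
      exact h h3.symm
  rw [h1, h2, ← Finset.sum_filter_add_sum_filter_not _ (fun f => f ≠ fun _ => 1), Finset.filter_filter]
  ring

lemma B_eq (x : ℝ) (n N : ℕ) (hN : n / 2 ≤ N) : Bfun n x = coeff (n/2) (ss x N) := by
  classical
  unfold Bfun ss
  have hset : {p : Σ k : ℕ, Fin k → ℕ |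
      1 ≤ p.1 ∧ (∀ j, 0 < p.2 j) ∧ (∑ j, p.2 j) = n / 2 ∧ p.2 ≠ fun _ => 1} =
      ↑((Finset.Ico 1 (N+1)).sigma fun k => (Finset.piAntidiag (Finset.univ : Finset (Fin k)) (n/2)).filter
      (fun f => (∀ j, 0 < f j) ∧ f ≠ fun _ => 1)) := by
    ext ⟨k, f⟩
    simp only [Set.mem_ofPred_eq, Finset.mem_coe, Finset.mem_sigma, Finset.mem_Ico,
      Finset.mem_filter, Finset.mem_piAntidiag]
    constructor
    · rintro ⟨h1, h2, h3, h4⟩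
      refine ⟨⟨h1, ?_⟩, ⟨h3, by simp⟩, h2, h4⟩
      have : ∑ j : Fin k, 1 ≤ ∑ j, f j := Finset.sum_le_sum fun j _ => h2 j
      simp at this
      omega
    · rintro ⟨⟨h1, _⟩, ⟨h3, _⟩, h2, h4⟩
      exact ⟨h1, h2, h3, h4⟩
  rw [hset, finsum_mem_coe_finset, Finset.sum_sigma, Finset.sum_Ico_eq_sum_range, map_sum]
  refine Finset.sum_congr (by simp) fun k _ => ?_
  rw [coeff_C_mul, add_comm k 1, coeff_cc_pow_sub, Finset.mul_sum]
  refine Finset.sum_congr rfl fun f _ => ?_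
  congr 2
  change 2 * (1 + k) - 2 = 2 * k
  omega

lemma coeff_low (x : ℝ) (m : ℕ) (hm : m < 4) : coeff m (TT (FF x)) = 0 := by
  have h := FF_mul x
  have hd : (X : PowerSeries ℝ) ∣ TT AA := by
    rw [TA, X_dvd_iff, constantCoeff_expand, cc0]
  have hu : IsUnit ((1 - C (x^2) * TT AA) * (1 - C (x^2) * (X * X)) : PowerSeries ℝ) := by
    rw [isUnit_iff_constantCoeff]
    rw [X_dvd_iff] at hd
    simp [hd]
  have h4 : (X : PowerSeries ℝ) ^ 4 ∣ TT (FF x) := by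
    rw [← hu.dvd_mul_right, h, TA]
    have e : expand 2 two_ne_zero cc - X * X = expand 2 two_ne_zero (cc - X) := by
      simp [expand_X, sq]
    have e2 : (X : PowerSeries ℝ) ^ 4 = expand 2 two_ne_zero (X ^ 2) := by
      rw [map_pow, expand_X]; ring
    rw [e, e2]
    apply map_dvd
    rw [X_pow_dvd_iff]
    intro i hi
    interval_cases i
    · simp [cc0]
    · simp [cc, C_two, coeff_one_X]
  exact X_pow_dvd_iff.mp h4 m hm

end BT

/-- for every real `x`, the function
`z ↦ (4·arcsin(z/2)² − z²)/((1 − 4x²·arcsin(z/2)²)(1 − x²z²))` is real-analytic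
at `0`; its Taylor coefficients of odd order and of orders `0` and `2` vanish,
and for even `n ≥ 4` its Taylor coefficient of order `n` equals `B_n(x)`. -/
theorem Bfun_taylor_coeffs (x : ℝ) :
    AnalyticAt ℝ (fun z : ℝ =>
        (4 * Real.arcsin (z / 2) ^ 2 - z ^ 2) /
          ((1 - 4 * x ^ 2 * Real.arcsin (z / 2) ^ 2) * (1 - x ^ 2 * z ^ 2))) 0 ∧
    (∀ m : ℕ, Odd m →
      iteratedDeriv m (fun z : ℝ =>
        (4 * Real.arcsin (z / 2) ^ 2 - z ^ 2) /
          ((1 - 4 * x ^ 2 * Real.arcsin (z / 2) ^ 2) * (1 - x ^ 2 * z ^ 2))) 0 /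
        (m.factorial : ℝ) = 0) ∧
    (∀ m : ℕ, m = 0 ∨ m = 2 →
      iteratedDeriv m (fun z : ℝ =>
        (4 * Real.arcsin (z / 2) ^ 2 - z ^ 2) /
          ((1 - 4 * x ^ 2 * Real.arcsin (z / 2) ^ 2) * (1 - x ^ 2 * z ^ 2))) 0 /
        (m.factorial : ℝ) = 0) ∧
    ∀ n : ℕ, Even n → 4 ≤ n →
      iteratedDeriv n (fun z : ℝ =>
        (4 * Real.arcsin (z / 2) ^ 2 - z ^ 2) /
          ((1 - 4 * x ^ 2 * Real.arcsin (z / 2) ^ 2) * (1 - x ^ 2 * z ^ 2))) 0 /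
        (n.factorial : ℝ) = Bfun n x := by
  have key : ∀ m : ℕ, iteratedDeriv m (BT.FF x) 0 / (m.factorial : ℝ)
      = PowerSeries.coeff m (TT (BT.FF x)) := by
    intro m; simp [TT]
  refine ⟨BT.FF_an x, ?_, ?_, ?_⟩
  · intro m hm
    refine (key m).trans ?_
    rw [BT.coeff_TF x le_rfl, PowerSeries.coeff_expand_of_not_dvd]
    exact fun h => (Nat.not_even_iff_odd.mpr hm) (even_iff_two_dvd.mpr h)
  · intro m hm
    exact (key m).trans (BT.coeff_low x m (by omega))
  · intro n hn _
    refine (key n).trans ?_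
    rw [BT.B_eq x n n (by omega), BT.coeff_TF x le_rfl]
    obtain ⟨r, rfl⟩ := even_iff_two_dvd.mp hn
    rw [PowerSeries.coeff_expand_mul, Nat.mul_div_cancel_left r two_pos]
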